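/- Let R be a commutative ring, n ≥ 1, κ = (κ₁,…,κ_n) positive integers with N = κ₁+⋯+κ_n, y₁,…,y_n ∈ R, q ∈ {1,…,n}, r ∈ {1,…,κ_q}, and d ∈ ℤ. Then ∑_{l=0}^{N−r} (−1)^l · h_{d−l}(y^[κ]) · e_l(y^[κ − r b_q]) = binom(r+d−1, r−1) · h_d(y_q), where for d < 0 both sides are 0 and for d ≥ 0 the right-hand side equals binom(r+d−1, r−1)·y_q^d. -/

import Mathlib

open scoped BigOperators

/-- Complete homogeneous polynomial of degree `m` evaluated at the list `l`
(`h₀ = 1`, `h_m = 0` for `m < 0`). -/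
def homEval {R : Type*} [CommRing R] (l : List R) (m : ℤ) : R :=
  if 0 ≤ m then
    ∑ f ∈ Finset.Nat.antidiagonalTuple l.length m.toNat, ∏ i, l.get i ^ f i
  else 0

/-- Elementary symmetric polynomial of degree `k` evaluated at the list `l`. -/
def esymmEval {R : Type*} [CommRing R] (l : List R) (k : ℕ) : R :=
  (((l : Multiset R).powersetCard k).map Multiset.prod).sum

/-- Power sum of degree `s` evaluated at the list `l`. -/
def psumEval {R : Type*} [CommRing R] (l : List R) (s : ℕ) : R :=
  (l.map (· ^ s)).sum

/-- The list `y^[κ]`: `y q` repeated `κ q` times, in order. -/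
def repList {R : Type*} {n : ℕ} (y : Fin n → R) (κ : Fin n → ℕ) : List R :=
  (List.ofFn fun q => List.replicate (κ q) (y q)).flatten

/-- Zero-based version of `γ(κ, p) = (q, r)`: the `p`-th entry (0-based) of the list
    `(0,0),…,(0,κ₀−1),(1,0),…,(1,κ₁−1),…`. -/
def gammaPair (n : ℕ) (κ : Fin n → ℕ) (p : ℕ) : ℕ × ℕ :=
  ((List.ofFn fun q : Fin n => (List.range (κ q)).map fun r => ((q : ℕ), r)).flatten).getD p (0, 0)

/-- The generalized confluent Vandermonde matrix `G_λ(y, κ)` (zero-based indices):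
`G[j,p] = binom(N+λ_j−j−1, r) · y_q^(N+λ_j−j−r−1)` if the exponent is `≥ 0`, else `0`,
where `(q, r) = gammaPair n κ p`. -/
def vanG (R : Type*) [CommRing R] {n : ℕ} (N : ℕ) (κ : Fin n → ℕ) (y : Fin n → R)
    (lam : Fin N → ℕ) : Matrix (Fin N) (Fin N) R :=
  Matrix.of fun j p =>
    if h : (gammaPair n κ (p : ℕ)).1 < n ∧
        (j : ℕ) + (gammaPair n κ (p : ℕ)).2 + 1 ≤ N + lam j then
      (Nat.choose (N + lam j - ((j : ℕ) + 1)) (gammaPair n κ (p : ℕ)).2 : R) *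
        y ⟨(gammaPair n κ (p : ℕ)).1, h.1⟩ ^
          (N + lam j - ((j : ℕ) + (gammaPair n κ (p : ℕ)).2 + 1))
    else 0

/-- The Jacobi–Trudi matrix `J_λ(x) = [h_{λ_j − j + k}(x)]`. -/
def jacobiTrudi (R : Type*) [CommRing R] (N : ℕ) (lam : Fin N → ℕ) (x : List R) :
    Matrix (Fin N) (Fin N) R :=
  Matrix.of fun j k => homEval x ((lam j : ℤ) - (j : ℕ) + (k : ℕ))

/-- The matrix `M(y, κ)` with entries `(−1)^{N−k−r+1} e_{N−k−r+1}(y^[κ − r b_q])`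
(in one-based form); entries with `N−k−r+1 < 0` are `0`. -/
def matM (R : Type*) [CommRing R] {n : ℕ} (N : ℕ) (κ : Fin n → ℕ) (y : Fin n → R) :
    Matrix (Fin N) (Fin N) R :=
  Matrix.of fun k p =>
    if h : (gammaPair n κ (p : ℕ)).1 < n ∧
        (k : ℕ) + (gammaPair n κ (p : ℕ)).2 + 1 ≤ N then
      (-1 : R) ^ (N - ((k : ℕ) + (gammaPair n κ (p : ℕ)).2 + 1)) *
        esymmEval
          (repList y (Function.update κ ⟨(gammaPair n κ (p : ℕ)).1, h.1⟩
            (κ ⟨(gammaPair n κ (p : ℕ)).1, h.1⟩ - ((gammaPair n κ (p : ℕ)).2 + 1))))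
          (N - ((k : ℕ) + (gammaPair n κ (p : ℕ)).2 + 1))
    else 0

/-- The column vector `H^N_{s,λ}(l) = (h_{s + λ_j − j}(l))_{j=1}^N` (one-based `j`). -/
def Hcol {R : Type*} [CommRing R] {N : ℕ} (lam : Fin N → ℕ) (s : ℕ) (l : List R) :
    Fin N → R :=
  fun j => homEval l ((s : ℤ) + lam j - ((j : ℕ) + 1))

/-- Splitting off the first entry of the tuples in `antidiagonalTuple (k + 1) m`. -/
theorem sum_antidiagonalTuple_succ {M : Type*} [AddCommMonoid M] (k m : ℕ)
    (F : (Fin (k + 1) → ℕ) → M) :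
    ∑ f ∈ Finset.Nat.antidiagonalTuple (k + 1) m, F f =
      ∑ p ∈ Finset.HasAntidiagonal.antidiagonal m,
        ∑ f ∈ Finset.Nat.antidiagonalTuple k p.2, F (Fin.cons p.1 f) := by
  rw [Finset.sum_sigma']
  refine Finset.sum_bij' (fun f _ => ⟨(f 0, ∑ i, Fin.tail f i), Fin.tail f⟩)
    (fun x _ => Fin.cons x.1.1 x.2) ?_ ?_ ?_ ?_ ?_
  · intro f hf
    simpa [Finset.Nat.mem_antidiagonalTuple, Fin.sum_univ_succ, Fin.tail] using hf
  · rintro ⟨⟨a, b⟩, f⟩ hf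
    simp only [Finset.mem_sigma, Finset.HasAntidiagonal.mem_antidiagonal,
      Finset.Nat.mem_antidiagonalTuple] at hf
    simp [Finset.Nat.mem_antidiagonalTuple, Fin.sum_univ_succ, hf.1, hf.2]
  · intro f _
    simp
  · rintro ⟨⟨a, b⟩, f⟩ hf
    simp only [Finset.mem_sigma, Finset.HasAntidiagonal.mem_antidiagonal,
      Finset.Nat.mem_antidiagonalTuple] at hf
    simp [hf.2]
  · intro f _
    simp

theorem homEval_natCast {R : Type*} [CommRing R] (l : List R) (m : ℕ) :
    homEval l m = ∑ f ∈ Finset.Nat.antidiagonalTuple l.length m, ∏ i, l.get i ^ f i := by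
  simp [homEval]

theorem homEval_of_neg {R : Type*} [CommRing R] (l : List R) {m : ℤ} (hm : m < 0) :
    homEval l m = 0 :=
  if_neg hm.not_ge

theorem homEval_singleton {R : Type*} [CommRing R] (a : R) (m : ℕ) :
    homEval [a] m = a ^ m := by
  simp [homEval_natCast]

theorem esymmEval_of_length_lt {R : Type*} [CommRing R] {l : List R} {k : ℕ}
    (h : l.length < k) : esymmEval l k = 0 := by
  rw [esymmEval, Multiset.powersetCard_eq_empty k (by simpa using h)]
  simp

/-- Generating function of the complete homogeneous symmetric polynomials. -/
theorem mk_homEval {R : Type*} [CommRing R] (l : List R) :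
    (PowerSeries.mk fun m : ℕ => homEval l m) =
      (l.map fun a => PowerSeries.mk fun m => a ^ m).prod := by
  induction l with
  | nil =>
    ext m
    cases m with
    | zero => simp [homEval_natCast]
    | succ m => simp [homEval_natCast, PowerSeries.coeff_one, -Nat.cast_add]
  | cons a l ih =>
    rw [List.map_cons, List.prod_cons, ← ih]
    ext m
    simp only [PowerSeries.coeff_mul, PowerSeries.coeff_mk, homEval_natCast]
    refine (sum_antidiagonalTuple_succ l.length m _).trans (Finset.sum_congr rfl fun p _ => ?_)
    rw [Finset.mul_sum]
    refine Finset.sum_congr rfl fun f _ => ?_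
    exact (Fin.prod_univ_succ (n := l.length) _).trans (by simp)

/-- Generating function of the signed elementary symmetric polynomials. -/
theorem mk_neg_one_pow_mul_esymmEval {R : Type*} [CommRing R] (l : List R) :
    (PowerSeries.mk fun k : ℕ => (-1) ^ k * esymmEval l k) =
      (l.map fun a => 1 - PowerSeries.C a * PowerSeries.X).prod := by
  induction l with
  | nil =>
    ext k
    cases k with
    | zero => simp [esymmEval]
    | succ k => simp [esymmEval, PowerSeries.coeff_one, Multiset.powersetCard_zero_right]
  | cons a l ih =>
    rw [List.map_cons, List.prod_cons, ← ih]
    ext k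
    cases k with
    | zero => simp [esymmEval, sub_mul, mul_assoc]
    | succ k =>
      have h : esymmEval (a :: l) (k + 1) = esymmEval l (k + 1) + a * esymmEval l k := by
        simp [esymmEval, ← Multiset.cons_coe, Multiset.powersetCard_cons,
          Multiset.sum_map_mul_left]
      simp only [sub_mul, one_mul, mul_assoc, map_sub, PowerSeries.coeff_C_mul,
        PowerSeries.coeff_succ_X_mul, PowerSeries.coeff_mk, h]
      ring

theorem mk_pow_mul_one_sub_C_mul_X {R : Type*} [CommRing R] (a : R) :
    (PowerSeries.mk fun m => a ^ m) * (1 - PowerSeries.C a * PowerSeries.X) = 1 := by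
  simpa [PowerSeries.rescale_mk, PowerSeries.rescale_X] using
    congrArg (PowerSeries.rescale a) (PowerSeries.mk_one_mul_one_sub_eq_one R)

theorem coeff_mk_pow_pow {R : Type*} [CommRing R] (a : R) {r : ℕ} (hr : 1 ≤ r) (m : ℕ) :
    PowerSeries.coeff m ((PowerSeries.mk fun m => a ^ m) ^ r) =
      (Nat.choose (r + m - 1) (r - 1) : R) * a ^ m := by
  obtain ⟨s, rfl⟩ := Nat.exists_eq_add_of_le' hr
  have h : (PowerSeries.mk fun m => a ^ m) = PowerSeries.rescale a (PowerSeries.mk 1) := by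
    simp [PowerSeries.rescale_mk]
  rw [h, ← map_pow, PowerSeries.mk_one_pow_eq_mk_choose_add, PowerSeries.coeff_rescale,
    PowerSeries.coeff_mk, mul_comm, Nat.add_sub_cancel, Nat.add_right_comm, Nat.add_sub_cancel]

theorem length_repList {R : Type*} {n : ℕ} (y : Fin n → R) (κ : Fin n → ℕ) :
    (repList y κ).length = ∑ q, κ q := by
  simp [repList, List.length_flatten, List.map_ofFn, Function.comp_def, List.sum_ofFn]

theorem prod_map_repList {R M : Type*} [CommMonoid M] {n : ℕ} (y : Fin n → R)
    (κ : Fin n → ℕ) (g : R → M) :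
    ((repList y κ).map g).prod = ∏ q, g (y q) ^ κ q := by
  simp [repList, List.map_flatten, List.prod_flatten, List.map_ofFn, Function.comp_def,
    List.prod_ofFn]

/-- `∑_{l=0}^{N−r} (−1)^l h_{d−l}(y^[κ]) e_l(y^[κ − r b_q])
= binom(r+d−1, r−1) h_d(y_q)` (both sides vanish for `d < 0`). -/
theorem sum_hom_mul_esymm {R : Type*} [CommRing R]
    (n : ℕ) (hn : 1 ≤ n) (κ : Fin n → ℕ) (hκ : ∀ q, 0 < κ q)
    (N : ℕ) (hN : N = ∑ q, κ q) (y : Fin n → R)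
    (q : Fin n) (r : ℕ) (hr1 : 1 ≤ r) (hr2 : r ≤ κ q) (d : ℤ) :
    ∑ l ∈ Finset.range (N - r + 1),
        (-1 : R) ^ l * homEval (repList y κ) (d - l) *
          esymmEval (repList y (Function.update κ q (κ q - r))) l =
      (Nat.choose (r + d.toNat - 1) (r - 1) : R) * homEval [y q] d := by
  rcases lt_or_ge d 0 with hd | hd
  · rw [homEval_of_neg _ hd, mul_zero]
    refine Finset.sum_eq_zero fun l _ => ?_
    rw [homEval_of_neg _ (by omega), mul_zero, zero_mul]
  lift d to ℕ using hd
  set κ' := Function.update κ q (κ q - r) with hκ'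
  have hlen : (repList y κ').length = N - r := by
    have h := Finset.add_sum_erase Finset.univ κ (Finset.mem_univ q)
    rw [length_repList, hκ', Finset.sum_update_of_mem (Finset.mem_univ q),
      Finset.sdiff_singleton_eq_erase]
    omega
  have hseries : (PowerSeries.mk fun k : ℕ => (-1) ^ k * esymmEval (repList y κ') k) *
      (PowerSeries.mk fun m : ℕ => homEval (repList y κ) m) =
        (PowerSeries.mk fun m => y q ^ m) ^ r := by
    rw [mk_neg_one_pow_mul_esymmEval, mk_homEval, prod_map_repList, prod_map_repList,
      ← Finset.prod_mul_distrib, Finset.prod_eq_single q]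
    · rw [hκ', Function.update_self]
      conv_lhs => rw [← Nat.sub_add_cancel hr2, Nat.add_sub_cancel, pow_add, ← mul_assoc,
        ← mul_pow, mul_comm (1 - _), mk_pow_mul_one_sub_C_mul_X, one_pow, one_mul]
    · intro p _ hp
      rw [hκ', Function.update_of_ne hp, ← mul_pow, mul_comm, mk_pow_mul_one_sub_C_mul_X, one_pow]
    · simp
  rw [Int.toNat_natCast, homEval_singleton, ← coeff_mk_pow_pow (y q) hr1, ← hseries,
    PowerSeries.coeff_mul]
  simp only [PowerSeries.coeff_mk]
  rw [Finset.Nat.sum_antidiagonal_eq_sum_range_succ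
    (fun k m => (-1) ^ k * esymmEval (repList y κ') k * homEval (repList y κ) m)]
  have hext (s : ℕ) (hs : s ≤ max (N - r) d)
      (h : ∀ l, s < l → homEval (repList y κ) ((d : ℤ) - l) * esymmEval (repList y κ') l = 0) :
      ∑ l ∈ Finset.range (s + 1),
        (-1 : R) ^ l * (homEval (repList y κ) ((d : ℤ) - l) * esymmEval (repList y κ') l) =
      ∑ l ∈ Finset.range (max (N - r) d + 1),
        (-1 : R) ^ l * (homEval (repList y κ) ((d : ℤ) - l) * esymmEval (repList y κ') l) := by
    refine Finset.sum_subset (Finset.range_mono (by omega)) fun l _ hl => ?_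
    rw [h l (by simpa [Nat.lt_succ_iff] using hl), mul_zero]
  simp only [mul_assoc]
  rw [hext (N - r) (le_max_left _ _) fun l hl => by
      rw [esymmEval_of_length_lt (hlen ▸ hl), mul_zero],
    ← hext d (le_max_right _ _) fun l hl => by rw [homEval_of_neg _ (by omega), zero_mul]]
  refine Finset.sum_congr rfl fun l hl => ?_
  rw [Nat.cast_sub (Nat.lt_succ_iff.mp (Finset.mem_range.mp hl)), mul_comm (homEval _ _)]
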